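/- arXiv:1508.07315 — 2 statements merged into one kernel-verified Lean document; each statement's English description precedes it below -/
import Mathlib

section
/- A connected simple graph G is weakly Farkas if and only if it satisfies the odd-cycle condition: for every two vertex-disjoint simple odd cycles of G there exist two vertices, one from each cycle, that are connected by an edge. -/
open Finset

/-- The vectors `v i` are almost Farkas-related. -/
def AFR {ι V : Type*} [Fintype ι] (v : ι → V → ℤ) : Prop :=
  ∀ a b : ι → ℤ, (∀ i, a i ≤ b i) →
  ∀ w : V → ℤ,
    (∃ c : ι → ℤ, (∀ i, a i = b i → c i = a i) ∧ ∀ j, w j = ∑ i, c i * v i j) →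
    (∃ x : ι → ℚ, (∀ i, (a i : ℚ) ≤ x i ∧ x i ≤ (b i : ℚ)) ∧
      ∀ j, (w j : ℚ) = ∑ i, x i * (v i j : ℚ)) →
    ∃ y : ι → ℤ, (∀ i, a i ≤ y i ∧ y i ≤ b i) ∧ ∀ j, w j = ∑ i, y i * v i j

/-- The vectors `v i` are weakly Farkas-related. -/
def WFR {ι V : Type*} [Fintype ι] (v : ι → V → ℤ) : Prop :=
  ∀ a b : ι → ℤ, (∀ i, a i < b i) →
  ∀ w : V → ℤ,
    (∃ c : ι → ℤ, ∀ j, w j = ∑ i, c i * v i j) →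
    (∃ x : ι → ℚ, (∀ i, (a i : ℚ) ≤ x i ∧ x i ≤ (b i : ℚ)) ∧
      ∀ j, (w j : ℚ) = ∑ i, x i * (v i j : ℚ)) →
    ∃ y : ι → ℤ, (∀ i, a i ≤ y i ∧ y i ≤ b i) ∧ ∀ j, w j = ∑ i, y i * v i j

/-- `∑ i, a i • v i = 0` is an elementary integral relation: it is a nontrivial relation
and every integral relation supported on `{i | a i ≠ 0}` is an integer multiple of `a`. -/
def IsElemRel {ι V : Type*} [Fintype ι] (v : ι → V → ℤ) (a : ι → ℤ) : Prop :=
  (∃ i, a i ≠ 0) ∧ (∀ j, ∑ i, a i * v i j = 0) ∧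
  ∀ b : ι → ℤ, (∀ i, a i = 0 → b i = 0) → (∀ j, ∑ i, b i * v i j = 0) →
    ∃ l : ℤ, ∀ i, b i = l * a i

/-- The vector `e_x + e_y` attached to an edge `e = {x, y}` of a simple graph. -/
def edgeVec {V : Type*} [DecidableEq V] (e : Sym2 V) : V → ℤ :=
  fun z => if z ∈ e then 1 else 0

/-- A graph is almost Farkas if its edge vectors are almost Farkas-related. -/
def GraphAFR {V : Type*} [Fintype V] [DecidableEq V] (G : SimpleGraph V)
    [DecidableRel G.Adj] : Prop :=
  AFR (fun e : G.edgeFinset => edgeVec (e : Sym2 V))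

/-- A graph is weakly Farkas if its edge vectors are weakly Farkas-related. -/
def GraphWFR {V : Type*} [Fintype V] [DecidableEq V] (G : SimpleGraph V)
    [DecidableRel G.Adj] : Prop :=
  WFR (fun e : G.edgeFinset => edgeVec (e : Sym2 V))

section AltWeight

variable {V : Type*} [DecidableEq V] {G : SimpleGraph V}

lemma edgeVec_mk {u v : V} (h : u ≠ v) (z : V) :
    edgeVec s(u, v) z = (Pi.single u 1 : V → ℤ) z + (Pi.single v 1 : V → ℤ) z := by
  by_cases hu : z = u <;> by_cases hv : z = v <;> simp_all [edgeVec]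

/-- The alternating edge weighting `e₁ - e₂ + e₃ - ⋯` of a walk. -/
def altWeight : {u v : V} → G.Walk u v → Sym2 V → ℤ
  | _, _, .nil => 0
  | u, _, .cons (v := v) _ p => Pi.single s(u, v) 1 - altWeight p

lemma altWeight_eq_zero {u v : V} {p : G.Walk u v} {e : Sym2 V} (he : e ∉ p.edges) :
    altWeight p e = 0 := by
  induction p with
  | nil => simp [altWeight]
  | cons h p ih =>
    simp only [SimpleGraph.Walk.edges_cons, List.mem_cons, not_or] at he
    simp [altWeight, ih he.2, he.1]

lemma altWeight_of_isTrail {u v : V} {p : G.Walk u v} (hp : p.IsTrail) {e : Sym2 V}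
    (he : e ∈ p.edges) : altWeight p e = 1 ∨ altWeight p e = -1 := by
  induction p with
  | nil => simp at he
  | @cons a b _ h p ih =>
    rw [SimpleGraph.Walk.isTrail_cons] at hp
    by_cases heq : e = s(a, b)
    · subst heq
      simp [altWeight, altWeight_eq_zero hp.2]
    · have := ih hp.1 (by simpa [heq] using he)
      simp only [altWeight, Pi.sub_apply, Pi.single_apply, if_neg heq]
      omega

lemma even_count_edges_add_altWeight {u v : V} (p : G.Walk u v) (e : Sym2 V) :
    Even ((p.edges.count e : ℤ) + altWeight p e) := by
  induction p with
  | nil => simp [altWeight]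
  | @cons a b _ h p ih =>
    obtain ⟨k, hk⟩ := ih
    by_cases heq : e = s(a, b)
    · subst heq
      refine ⟨p.edges.count s(a, b) + 1 - k, ?_⟩
      simp [altWeight]
      omega
    · refine ⟨p.edges.count e - k, ?_⟩
      simp [altWeight, List.count_cons_of_ne (Ne.symm heq), heq]
      omega

lemma sum_count_tail_support {u v : V} (p : G.Walk u v) :
    ∑ z ∈ p.support.toFinset, p.support.tail.count z = p.length := by
  have h := Multiset.sum_count_eq_card (s := p.support.toFinset)
    (m := (p.support.tail : Multiset V))
    fun z hz => by simpa using List.mem_of_mem_tail hz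
  simpa using h

end AltWeight

section EdgeSum

variable {V : Type*} [Fintype V] [DecidableEq V]

/-- The linear map sending an edge weighting to the vector of its vertex sums. -/
def edgeSum (R : Type*) [CommRing R] : (Sym2 V → R) →ₗ[R] (V → R) where
  toFun x z := ∑ e, x e * ((edgeVec e z : ℤ) : R)
  map_add' x y := by ext z; simp [add_mul, sum_add_distrib]
  map_smul' r x := by ext z; simp [mul_assoc, mul_sum]

lemma edgeSum_apply {R : Type*} [CommRing R] (x : Sym2 V → R) (z : V) :
    edgeSum R x z = ∑ e, x e * ((edgeVec e z : ℤ) : R) := rfl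

lemma edgeSum_cast (x : Sym2 V → ℤ) (z : V) :
    edgeSum ℚ (fun e => (x e : ℚ)) z = ((edgeSum ℤ x z : ℤ) : ℚ) := by
  simp [edgeSum_apply]

lemma edgeSum_single {R : Type*} [CommRing R] {u v : V} (h : u ≠ v) (r : R) :
    edgeSum R (Pi.single s(u, v) r) = Pi.single u r + Pi.single v r := by
  ext z
  rw [edgeSum_apply, Finset.sum_eq_single s(u, v)]
  · rw [edgeVec_mk h]
    by_cases hu : z = u <;> by_cases hv : z = v <;> simp_all
  · intro e _ he
    simp [he]
  · simp

lemma sum_edgeVec {G : SimpleGraph V} {e : Sym2 V} (he : e ∈ G.edgeSet) :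
    ∑ z, edgeVec e z = 2 := by
  induction e with
  | h u v =>
    have h : u ≠ v := G.ne_of_adj he
    simp [edgeVec_mk h, sum_add_distrib]

lemma sum_edgeSum {R : Type*} [CommRing R] {G : SimpleGraph V} {x : Sym2 V → R}
    (hx : ∀ e ∉ G.edgeSet, x e = 0) : ∑ z, edgeSum R x z = 2 * ∑ e, x e := by
  simp only [edgeSum_apply]
  rw [sum_comm, mul_sum]
  refine sum_congr rfl fun e _ => ?_
  by_cases he : e ∈ G.edgeSet
  · rw [← mul_sum, ← Int.cast_sum, sum_edgeVec he]
    push_cast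
    ring
  · simp [hx e he]

section Bridge

variable (G : SimpleGraph V) [DecidableRel G.Adj]

/-- Extension by zero of a function on the edges of `G` to all unordered pairs. -/
def extendEdges {R : Type*} [Zero R] (c : G.edgeFinset → R) (e : Sym2 V) : R :=
  if h : e ∈ G.edgeFinset then c ⟨e, h⟩ else 0

variable {G}

lemma extendEdges_coe {R : Type*} [Zero R] (c : G.edgeFinset → R) (e : G.edgeFinset) :
    extendEdges G c e = c e := by
  simp only [extendEdges, e.2, dif_pos]

lemma extendEdges_of_notMem {R : Type*} [Zero R] (c : G.edgeFinset → R) {e : Sym2 V}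
    (he : e ∉ G.edgeSet) : extendEdges G c e = 0 := by
  simp [extendEdges, he]

lemma sum_edgeFinset_coe {R : Type*} [CommRing R] {x : Sym2 V → R}
    (hx : ∀ e ∉ G.edgeSet, x e = 0) (z : V) :
    ∑ e : G.edgeFinset, x e * ((edgeVec (e : Sym2 V) z : ℤ) : R) = edgeSum R x z := by
  rw [edgeSum_apply, Finset.sum_coe_sort G.edgeFinset (fun e => x e * ((edgeVec e z : ℤ) : R))]
  refine Finset.sum_subset (subset_univ _) fun e _ he => ?_
  rw [hx e (by simpa using he), zero_mul]

lemma edgeSum_extendEdges {R : Type*} [CommRing R] (c : G.edgeFinset → R) (z : V) :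
    edgeSum R (extendEdges G c) z =
      ∑ e : G.edgeFinset, c e * ((edgeVec (e : Sym2 V) z : ℤ) : R) := by
  rw [← sum_edgeFinset_coe (G := G) fun e he => extendEdges_of_notMem c he]
  simp only [extendEdges_coe]

/-- The weak Farkas property, in terms of weightings of all unordered pairs that vanish
off the edges. -/
lemma graphWFR_iff : GraphWFR G ↔
    ∀ a b : Sym2 V → ℤ, (∀ e ∈ G.edgeSet, a e < b e) → (∀ e ∉ G.edgeSet, a e = 0 ∧ b e = 0) →
    ∀ c : Sym2 V → ℤ, (∀ e ∉ G.edgeSet, c e = 0) →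
    ∀ x : Sym2 V → ℚ, (∀ e, (a e : ℚ) ≤ x e ∧ x e ≤ (b e : ℚ)) →
      (∀ z, edgeSum ℚ x z = ((edgeSum ℤ c z : ℤ) : ℚ)) →
    ∃ y : Sym2 V → ℤ, (∀ e, a e ≤ y e ∧ y e ≤ b e) ∧ edgeSum ℤ y = edgeSum ℤ c := by
  constructor
  · intro h a b hab hab' c hc x hx hxc
    have hx0 : ∀ e ∉ G.edgeSet, x e = 0 := fun e he => by
      have h1 := hx e
      rw [(hab' e he).1, (hab' e he).2] at h1
      exact le_antisymm (by simpa using h1.2) (by simpa using h1.1)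
    obtain ⟨y, hy, hyw⟩ := h (fun e => a e) (fun e => b e)
      (fun e => hab e (SimpleGraph.mem_edgeFinset.mp e.2)) (edgeSum ℤ c)
      ⟨fun e => c e, fun j => by simpa using (sum_edgeFinset_coe hc j).symm⟩
      ⟨fun e => x e, fun e => hx e, fun j => by rw [← hxc, ← sum_edgeFinset_coe hx0 j]⟩
    refine ⟨extendEdges G y, fun e => ?_, ?_⟩
    · by_cases he : e ∈ G.edgeFinset
      · simpa [extendEdges, he] using hy ⟨e, he⟩
      · have he' : e ∉ G.edgeSet := by simpa using he
        simp [extendEdges_of_notMem y he', hab' e he']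
    · ext z
      rw [edgeSum_extendEdges, hyw]
      simp
  · intro h a b hab w ⟨c, hc⟩ ⟨x, hx, hxw⟩
    have hcw : edgeSum ℤ (extendEdges G c) = w := by
      ext z
      rw [edgeSum_extendEdges, hc]
      simp
    obtain ⟨y, hy, hyw⟩ := h (extendEdges G a) (extendEdges G b)
      (fun e he => by
        have he' : e ∈ G.edgeFinset := by simpa using he
        simpa [extendEdges, he'] using hab ⟨e, he'⟩)
      (fun e he => ⟨extendEdges_of_notMem a he, extendEdges_of_notMem b he⟩)
      (extendEdges G c) (fun e he => extendEdges_of_notMem c he) (extendEdges G x)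
      (fun e => by
        by_cases he : e ∈ G.edgeFinset
        · simpa [extendEdges, he] using hx ⟨e, he⟩
        · have he' : e ∉ G.edgeSet := by simpa using he
          simp [extendEdges_of_notMem _ he'])
      (fun z => by rw [edgeSum_extendEdges, hcw, hxw])
    refine ⟨fun e => y e, fun e => by simpa only [extendEdges_coe] using hy e, fun j => ?_⟩
    rw [← hcw, ← hyw, ← sum_edgeFinset_coe (G := G)]
    · simp
    · intro e he
      have h1 := hy e
      rw [extendEdges_of_notMem a he, extendEdges_of_notMem b he] at h1
      exact le_antisymm h1.2 h1.1

end Bridge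

section Walks

variable {G : SimpleGraph V}

lemma edgeSum_altWeight {u v : V} (p : G.Walk u v) :
    edgeSum ℤ (altWeight p) = Pi.single u 1 - (-1) ^ p.length • Pi.single v 1 := by
  induction p with
  | nil => simp [altWeight]
  | cons h p ih =>
    rw [altWeight, map_sub, ih, edgeSum_single h.ne, SimpleGraph.Walk.length_cons, pow_succ]
    simp only [mul_neg, mul_one, neg_smul]
    abel

lemma edgeSum_count_edges {u v : V} (p : G.Walk u v) :
    edgeSum ℤ (fun e => (p.edges.count e : ℤ)) + Pi.single v 1 =
      2 • (fun z => (p.support.tail.count z : ℤ)) + Pi.single u 1 := by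
  induction p with
  | nil =>
    ext z
    simp [edgeSum_apply]
  | @cons a b c h p ih =>
    have h1 : (fun e => ((SimpleGraph.Walk.cons h p).edges.count e : ℤ)) =
        (fun e => (p.edges.count e : ℤ)) + Pi.single s(a, b) 1 := by
      ext e
      simp [List.count_cons, Pi.single_apply, @eq_comm _ e]
    have h2 : (fun z => ((SimpleGraph.Walk.cons h p).support.tail.count z : ℤ)) =
        (fun z => (p.support.tail.count z : ℤ)) + Pi.single b 1 := by
      ext z
      rw [SimpleGraph.Walk.support_cons, List.tail_cons, ← p.cons_tail_support, List.tail_cons]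
      simp only [List.count_cons, Pi.add_apply, Pi.single_apply, beq_iff_eq, @eq_comm _ z]
      split_ifs <;> simp
    rw [h1, h2, map_add, edgeSum_single h.ne]
    linear_combination ih

lemma edgeSum_count_edges_of_closed {u : V} (p : G.Walk u u) (z : V) :
    edgeSum ℤ (fun e => (p.edges.count e : ℤ)) z = 2 * p.support.tail.count z := by
  have h := congrFun (add_right_cancel (edgeSum_count_edges p)) z
  rwa [Pi.smul_apply, nsmul_eq_mul] at h

end Walks

end EdgeSum

section OddCycles

variable {V : Type*} [Fintype V] [DecidableEq V] {G : SimpleGraph V}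

/-- An edge weighting that vanishes on the edges leaving `s` has even total vertex sum
over `s`. -/
lemma even_sum_edgeSum {s : Finset V} {y : Sym2 V → ℤ}
    (hy : ∀ e ∉ G.edgeSet, y e = 0) (hs : ∀ p ∈ s, ∀ q ∉ s, y s(p, q) = 0) :
    Even (∑ z ∈ s, edgeSum ℤ y z) := by
  simp only [edgeSum_apply]
  rw [sum_comm]
  refine Finset.even_sum _ fun e _ => ?_
  rw [← mul_sum]
  by_cases he : e ∈ G.edgeSet
  · induction e with
    | h p q =>
      have hpq : p ≠ q := G.ne_of_adj he
      simp only [edgeVec_mk hpq, Int.cast_id, sum_add_distrib]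
      by_cases hp : p ∈ s <;> by_cases hq : q ∈ s
      · simp [hp, hq]
      · simp [hs p hp q hq]
      · simp [Sym2.eq_swap ▸ hs q hq p hp]
      · simp [hp, hq]
  · simp [hy e he]

/-- In a connected graph, the sum of the vertices of two odd closed walks lies in the edge
lattice. -/
lemma exists_edgeSum_eq_count_support (hG : G.Connected) {x y : V} (c₁ : G.Walk x x)
    (c₂ : G.Walk y y) (ho₁ : Odd c₁.length) (ho₂ : Odd c₂.length) :
    ∃ c : Sym2 V → ℤ, (∀ e ∉ G.edgeSet, c e = 0) ∧ ∀ z, edgeSum ℤ c z =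
      c₁.support.tail.count z + c₂.support.tail.count z := by
  obtain ⟨r⟩ := hG.preconnected x y
  set W := c₁.append (r.append (c₂.append r.reverse)) with hW
  have hpar : ∀ e, ∃ k : ℤ, c₁.edges.count e + c₂.edges.count e + altWeight W e = 2 * k := by
    intro e
    obtain ⟨k, hk⟩ := even_count_edges_add_altWeight W e
    refine ⟨k - r.edges.count e, ?_⟩
    have : W.edges.count e =
        c₁.edges.count e + c₂.edges.count e + 2 * r.edges.count e := by
      simp only [hW, SimpleGraph.Walk.edges_append, SimpleGraph.Walk.edges_reverse,
        List.count_append, List.count_reverse]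
      ring
    rw [this] at hk
    push_cast at hk
    linarith
  choose c hc using hpar
  refine ⟨c, fun e he => ?_, fun z => ?_⟩
  · have h0 : ∀ {u v : V} (p : G.Walk u v), e ∉ p.edges :=
      fun p hp => he (p.edges_subset_edgeSet hp)
    have := hc e
    rw [List.count_eq_zero_of_not_mem (h0 _), List.count_eq_zero_of_not_mem (h0 _),
      altWeight_eq_zero (h0 _)] at this
    simpa using this.symm
  · have heven : Even W.length := by
      simp only [hW, SimpleGraph.Walk.length_append, SimpleGraph.Walk.length_reverse]
      grind
    have hW0 : edgeSum ℤ (altWeight W) = 0 := by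
      rw [edgeSum_altWeight, heven.neg_one_pow, one_smul, sub_self]
    have hsum : (fun e => (c₁.edges.count e : ℤ)) + (fun e => (c₂.edges.count e : ℤ)) +
        altWeight W = (2 : ℤ) • c := by
      ext e
      simpa using hc e
    have h := congrFun (congrArg (edgeSum ℤ) hsum) z
    simp only [map_add, map_smul, hW0, Pi.add_apply, Pi.smul_apply, Pi.zero_apply, smul_eq_mul,
      edgeSum_count_edges_of_closed] at h
    linarith

/-- In a connected weakly Farkas graph, disjoint odd cycles are joined by an edge. -/
lemma GraphWFR.exists_adj [DecidableRel G.Adj] (h : GraphWFR G) (hG : G.Connected) {x y : V}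
    {c₁ : G.Walk x x} {c₂ : G.Walk y y} (hc₁ : c₁.IsTrail) (hc₂ : c₂.IsTrail)
    (ho₁ : Odd c₁.length) (ho₂ : Odd c₂.length) (hd : ∀ z, z ∈ c₁.support → z ∉ c₂.support) :
    ∃ p ∈ c₁.support, ∃ q ∈ c₂.support, G.Adj p q := by
  by_contra! hno
  obtain ⟨c, hc0, hc⟩ := exists_edgeSum_eq_count_support hG c₁ c₂ ho₁ ho₂
  set N : Sym2 V → ℤ := fun e => c₁.edges.count e + c₂.edges.count e with hN
  have hNsum : ∀ z, edgeSum ℤ N z = 2 * edgeSum ℤ c z := by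
    intro z
    have h : N = (fun e => (c₁.edges.count e : ℤ)) + (fun e => (c₂.edges.count e : ℤ)) := rfl
    rw [h, map_add, hc, Pi.add_apply, edgeSum_count_edges_of_closed,
      edgeSum_count_edges_of_closed, mul_add]
  have hN0 : ∀ e ∉ G.edgeSet, N e = 0 := by
    intro e he
    have h0 : ∀ {u v : V} (p : G.Walk u v), e ∉ p.edges :=
      fun p hp => he (p.edges_subset_edgeSet hp)
    simp [hN, List.count_eq_zero_of_not_mem (h0 _)]
  have hN1 : ∀ e, 0 ≤ N e ∧ N e ≤ 2 := by
    intro e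
    have h₁ := hc₁.count_edges_le_one e
    have h₂ := hc₂.count_edges_le_one e
    simp only [hN]
    omega
  obtain ⟨y, hy, hyc⟩ := graphWFR_iff.mp h 0 (fun e => if e ∈ G.edgeSet then 1 else 0)
    (fun e he => by simp [he]) (fun e he => by simp [he]) c hc0 ((1 / 2 : ℚ) • fun e => (N e : ℚ))
    (fun e => by
      obtain ⟨h1, h2⟩ := hN1 e
      have h1' : (0 : ℚ) ≤ N e := by exact_mod_cast h1
      have h2' : (N e : ℚ) ≤ 2 := by exact_mod_cast h2
      by_cases he : e ∈ G.edgeSet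
      · simp only [Pi.smul_apply, smul_eq_mul, if_pos he, Pi.zero_apply]
        push_cast
        constructor <;> linarith
      · simp [he, hN0 e he])
    (fun z => by
      rw [map_smul, Pi.smul_apply, edgeSum_cast, hNsum]
      push_cast
      simp)
  have hy0 : ∀ e, 0 ≤ y e := fun e => (hy e).1
  have hsupp : ∀ e ∉ G.edgeSet, y e = 0 := fun e he => by
    have := hy e
    simp only [if_neg he] at this
    exact le_antisymm this.2 this.1
  have heven : Even (∑ z ∈ c₁.support.toFinset, edgeSum ℤ y z) := by
    refine even_sum_edgeSum hsupp fun p hp q hq => ?_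
    rw [List.mem_toFinset] at hp hq
    by_contra hne
    have hadj : G.Adj p q := by
      by_contra hadj
      exact hne (hsupp _ hadj)
    have hwq : edgeSum ℤ y q = 0 := by
      rw [hyc, hc, List.count_eq_zero_of_not_mem fun h => hq (List.mem_of_mem_tail h),
        List.count_eq_zero_of_not_mem fun h => hno p hp q (List.mem_of_mem_tail h) hadj]
      simp
    rw [edgeSum_apply, Finset.sum_eq_zero_iff_of_nonneg fun e _ => mul_nonneg (hy0 e) (by
      simp only [edgeVec]; split_ifs <;> simp)] at hwq
    simpa [edgeVec, hne] using hwq s(p, q) (mem_univ _)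
  have hodd : ∑ z ∈ c₁.support.toFinset, edgeSum ℤ y z = c₁.length := by
    rw [← sum_count_tail_support c₁, Nat.cast_sum]
    refine sum_congr rfl fun z hz => ?_
    rw [hyc, hc, List.count_eq_zero_of_not_mem (l := c₂.support.tail) fun h =>
      hd z (List.mem_toFinset.mp hz) (List.mem_of_mem_tail h)]
    simp
  rw [hodd, Int.even_coe_nat] at heven
  exact Nat.not_even_iff_odd.mpr ho₁ heven

end OddCycles

section Rounding

variable {ι : Type*} [Fintype ι]

/-- The indices at which a rational vector is not integral. -/
def fracSet (x : ι → ℚ) : Finset ι := {i | (⌊x i⌋ : ℚ) ≠ x i}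

lemma notMem_fracSet {x : ι → ℚ} {i : ι} :
    i ∉ fracSet x ↔ x i ∈ (Int.castRingHom ℚ).range := by
  simp only [fracSet, mem_filter, mem_univ, true_and, not_not]
  exact ⟨fun h => ⟨_, h⟩, by rintro ⟨n, hn⟩; simp [← hn]⟩

lemma exists_step {x d : ι → ℚ} (hd : ∀ i ∉ fracSet x, d i = 0) (hne : d ≠ 0) :
    ∃ t : ℚ, (∀ i, (⌊x i⌋ : ℚ) ≤ x i + t * d i ∧ x i + t * d i ≤ ⌈x i⌉) ∧
      fracSet (x + t • d) ⊂ fracSet x := by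
  let T : ι → ℚ := fun i => ((if 0 < d i then (⌈x i⌉ : ℚ) else ⌊x i⌋) - x i) / d i
  obtain ⟨j, hj⟩ := Function.ne_iff.mp hne
  obtain ⟨k, hk, hmin⟩ := Finset.exists_min_image {i | d i ≠ 0} T ⟨j, by simpa using hj⟩
  simp only [mem_filter, mem_univ, true_and] at hk hmin
  have hTnonneg : ∀ i, 0 ≤ T i := by
    intro i
    by_cases hi : 0 < d i
    · simp only [T, if_pos hi]
      exact div_nonneg (sub_nonneg.mpr (Int.le_ceil _)) hi.le
    · simp only [T, if_neg hi]
      exact div_nonneg_of_nonpos (sub_nonpos.mpr (Int.floor_le _)) (not_lt.mp hi)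
  have hTmul : ∀ i, d i ≠ 0 →
      x i + T i * d i = if 0 < d i then (⌈x i⌉ : ℚ) else ⌊x i⌋ := by
    intro i hi
    simp only [T, div_mul_cancel₀ _ hi]
    ring
  have hsub : ∀ i ∉ fracSet x, x i + T k * d i = x i := fun i hi => by simp [hd i hi]
  have hkF : k ∈ fracSet x := by
    by_contra h
    exact hk (hd k h)
  refine ⟨T k, fun i => ?_, Finset.ssubset_iff_subset_ne.mpr ⟨fun i hi => ?_, fun h => ?_⟩⟩
  · have hfl := Int.floor_le (x i)
    have hce := Int.le_ceil (x i)
    rcases lt_trichotomy (d i) 0 with hi | hi | hi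
    · have h1 := hTmul i hi.ne
      rw [if_neg hi.not_gt] at h1
      have h2 := mul_le_mul_of_nonpos_right (hmin i hi.ne) hi.le
      have h3 := mul_nonpos_of_nonneg_of_nonpos (hTnonneg k) hi.le
      constructor <;> linarith
    · simp [hi, hfl, hce]
    · have h1 := hTmul i hi.ne'
      rw [if_pos hi] at h1
      have h2 := mul_le_mul_of_nonneg_right (hmin i hi.ne') hi.le
      have h3 := mul_nonneg (hTnonneg k) hi.le
      constructor <;> linarith
  · by_contra hx
    refine notMem_fracSet.mpr ?_ hi
    rw [Pi.add_apply, Pi.smul_apply, smul_eq_mul, hsub i hx]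
    exact notMem_fracSet.mp hx
  · rw [← h] at hkF
    refine notMem_fracSet.mpr ?_ hkF
    rw [Pi.add_apply, Pi.smul_apply, smul_eq_mul, hTmul k hk]
    split_ifs
    · exact ⟨⌈x k⌉, rfl⟩
    · exact ⟨⌊x k⌋, rfl⟩

end Rounding

section Minimal

variable {V : Type*} [Fintype V] [DecidableEq V]

/-- A weighting in the box `[a, b]` with the least number of nonintegral weights among those
with the same vertex sums. -/
structure IsMinFrac (a b : Sym2 V → ℤ) (x : Sym2 V → ℚ) : Prop where
  mem_box : ∀ e, (a e : ℚ) ≤ x e ∧ x e ≤ b e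
  card_le : ∀ y : Sym2 V → ℚ, (∀ e, (a e : ℚ) ≤ y e ∧ y e ≤ b e) → edgeSum ℚ y = edgeSum ℚ x →
    #(fracSet x) ≤ #(fracSet y)

lemma exists_isMinFrac {a b : Sym2 V → ℤ} {x : Sym2 V → ℚ}
    (hx : ∀ e, (a e : ℚ) ≤ x e ∧ x e ≤ b e) :
    ∃ y, IsMinFrac a b y ∧ edgeSum ℚ y = edgeSum ℚ x := by
  induction hn : #(fracSet x) using Nat.strong_induction_on generalizing x with
  | _ n ih =>
    by_cases h : ∃ y : Sym2 V → ℚ, (∀ e, (a e : ℚ) ≤ y e ∧ y e ≤ b e) ∧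
        edgeSum ℚ y = edgeSum ℚ x ∧ #(fracSet y) < #(fracSet x)
    · obtain ⟨y, hy, hyx, hlt⟩ := h
      obtain ⟨y', hy', hyy'⟩ := ih _ (hn ▸ hlt) hy rfl
      exact ⟨y', hy', hyy'.trans hyx⟩
    · push Not at h
      exact ⟨x, ⟨hx, h⟩, rfl⟩

namespace IsMinFrac

variable {a b : Sym2 V → ℤ} {x : Sym2 V → ℚ}

lemma eq_zero_of_edgeSum_eq_zero (hx : IsMinFrac a b x) {d : Sym2 V → ℚ}
    (hd : ∀ e ∉ fracSet x, d e = 0) (hker : edgeSum ℚ d = 0) : d = 0 := by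
  by_contra hne
  obtain ⟨t, ht, hlt⟩ := exists_step hd hne
  refine (Finset.card_lt_card hlt).not_ge (hx.card_le _ (fun e => ?_) (by simp [hker]))
  have hfl : (a e : ℚ) ≤ ⌊x e⌋ := by exact_mod_cast Int.le_floor.mpr (hx.mem_box e).1
  have hce : (⌈x e⌉ : ℚ) ≤ b e := by exact_mod_cast Int.ceil_le.mpr (hx.mem_box e).2
  exact ⟨hfl.trans (ht e).1, (ht e).2.trans hce⟩

lemma mem_fracSet_of_integral_step (hx : IsMinFrac a b x) {y : Sym2 V → ℚ}
    (hy : ∀ e, y e = x e ∨ ∃ n : ℤ, y e = n ∧ a e ≤ n ∧ n ≤ b e)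
    (hsum : edgeSum ℚ y = edgeSum ℚ x) {e : Sym2 V} (he : e ∈ fracSet x) : e ∈ fracSet y := by
  have hsub : fracSet y ⊆ fracSet x := by
    intro i hi
    rcases hy i with h | ⟨n, hn, -⟩
    · by_contra hix
      refine notMem_fracSet.mpr ?_ hi
      rw [h]
      exact notMem_fracSet.mp hix
    · exact absurd hi (notMem_fracSet.mpr ⟨n, hn.symm⟩)
  rw [Finset.eq_of_subset_of_card_le hsub (hx.card_le y (fun i => ?_) hsum)]
  · exact he
  rcases hy i with h | ⟨n, hn, h1, h2⟩
  · rw [h]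
    exact hx.mem_box i
  · rw [hn]
    exact ⟨by exact_mod_cast h1, by exact_mod_cast h2⟩

/-- Nonintegral edges are linearly independent, so there are at most as many of them as there
are vertices on them. -/
lemma card_fracSet_le (hx : IsMinFrac a b x) :
    #(fracSet x) ≤ #{z : V | ∃ e ∈ fracSet x, z ∈ e} := by
  set S : Finset V := {z : V | ∃ e ∈ fracSet x, z ∈ e} with hS
  have hli : LinearIndependent ℚ
      (fun (e : fracSet x) (z : S) => ((edgeVec (e : Sym2 V) z : ℤ) : ℚ)) := by
    rw [Fintype.linearIndependent_iff]
    intro g hg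
    set d : Sym2 V → ℚ := fun e => if h : e ∈ fracSet x then g ⟨e, h⟩ else 0 with hd
    have hdF : ∀ e ∉ fracSet x, d e = 0 := fun e he => by simp [hd, he]
    have hd0 : d = 0 := by
      refine hx.eq_zero_of_edgeSum_eq_zero hdF ?_
      ext z
      rw [Pi.zero_apply, edgeSum_apply]
      by_cases hz : z ∈ S
      · have h := congrFun hg ⟨z, hz⟩
        rw [Finset.sum_apply] at h
        rw [← Finset.sum_subset (Finset.subset_univ (fracSet x)) fun e _ he => by
          rw [hdF e he, zero_mul], ← Finset.sum_coe_sort]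
        rw [Pi.zero_apply] at h
        rw [← h]
        refine sum_congr rfl fun e _ => ?_
        simp [hd]
      · refine Finset.sum_eq_zero fun e _ => ?_
        by_cases he : e ∈ fracSet x
        · have : z ∉ e := fun hze =>
            hz (mem_filter.mpr ⟨mem_univ z, e, he, hze⟩)
          simp [edgeVec, this]
        · rw [hdF e he, zero_mul]
    intro e
    simpa [hd] using congrFun hd0 e
  have h := hli.fintype_card_le_finrank
  simpa using h

end IsMinFrac

end Minimal

section FracGraph

variable {V : Type*} [Fintype V]

/-- The graph of the nonintegral edges of a weighting. -/
def fracGraph (x : Sym2 V → ℚ) : SimpleGraph V :=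
  SimpleGraph.fromEdgeSet (fracSet x : Set (Sym2 V))

variable {G : SimpleGraph V} {a b : Sym2 V → ℤ} {x : Sym2 V → ℚ}

lemma edgeSet_fracGraph (hG : ∀ e ∈ fracSet x, e ∈ G.edgeSet) :
    (fracGraph x).edgeSet = fracSet x := by
  rw [fracGraph, SimpleGraph.edgeSet_fromEdgeSet]
  exact sdiff_eq_left.mpr (Set.disjoint_left.mpr fun e he hd =>
    G.not_isDiag_of_mem_edgeSet (hG e he) hd)

lemma mem_fracSet_of_mem_edges {u v : V} {p : (fracGraph x).Walk u v} {e : Sym2 V}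
    (he : e ∈ p.edges) : e ∈ fracSet x := by
  have h := p.edges_subset_edgeSet he
  rw [fracGraph, SimpleGraph.edgeSet_fromEdgeSet] at h
  exact h.1

lemma fracGraph_le (hG : ∀ e ∈ fracSet x, e ∈ G.edgeSet) : fracGraph x ≤ G := by
  rw [← SimpleGraph.edgeSet_subset_edgeSet, edgeSet_fracGraph hG]
  exact fun e he => hG e he

lemma fracGraph_adj (hG : ∀ e ∈ fracSet x, e ∈ G.edgeSet) {u v : V} :
    (fracGraph x).Adj u v ↔ s(u, v) ∈ fracSet x := by
  rw [← SimpleGraph.mem_edgeSet, edgeSet_fracGraph hG, mem_coe]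

variable [DecidableEq V]

/-- The nonintegral edges of a weighting with integral vertex sums form a leafless graph. -/
lemma exists_ne_fracGraph_adj (hG : ∀ e ∈ fracSet x, e ∈ G.edgeSet)
    {z u : V} (hz : edgeSum ℚ x z ∈ (Int.castRingHom ℚ).range) (hzu : (fracGraph x).Adj z u) :
    ∃ v, v ≠ u ∧ (fracGraph x).Adj z v := by
  by_contra! h
  refine notMem_fracSet.mpr ?_ ((fracGraph_adj hG).mp hzu)
  have hrest : ∑ e ∈ univ.erase s(z, u), x e * ((edgeVec e z : ℤ) : ℚ) ∈
      (Int.castRingHom ℚ).range := by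
    refine sum_mem fun e he => ?_
    by_cases hze : z ∈ e
    · obtain ⟨v, rfl⟩ := hze
      have hv : v ≠ u := by
        rintro rfl
        simp at he
      refine mul_mem (notMem_fracSet.mp ?_) ⟨_, rfl⟩
      rw [← fracGraph_adj hG]
      exact h v hv
    · simp [edgeVec, hze]
  rw [edgeSum_apply, ← Finset.add_sum_erase _ _ (mem_univ s(z, u))] at hz
  have := sub_mem hz hrest
  simpa [edgeVec] using this

namespace IsMinFrac

lemma degree_fracGraph (hx : IsMinFrac a b x) (hG : ∀ e ∈ fracSet x, e ∈ G.edgeSet)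
    (hint : ∀ z, edgeSum ℚ x z ∈ (Int.castRingHom ℚ).range)
    [DecidableRel (fracGraph x).Adj] :
    #(fracSet x) = #{z : V | ∃ e ∈ fracSet x, z ∈ e} ∧
      ∀ z, (∃ e ∈ fracSet x, z ∈ e) → (fracGraph x).degree z = 2 := by
  have hle := hx.card_fracSet_le
  set S : Finset V := {z : V | ∃ e ∈ fracSet x, z ∈ e} with hS
  have hmem : ∀ z, z ∈ S ↔ ∃ e ∈ fracSet x, z ∈ e := fun z => by simp [hS]
  have hdeg : ∀ z ∈ S, 2 ≤ (fracGraph x).degree z := by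
    intro z hz
    obtain ⟨e, he, u, rfl⟩ := (hmem z).mp hz
    have hzu := (fracGraph_adj hG).mpr he
    obtain ⟨v, hvu, hzv⟩ := exists_ne_fracGraph_adj hG (hint z) hzu
    rw [← SimpleGraph.card_neighborFinset_eq_degree, ← Finset.card_pair hvu]
    refine Finset.card_le_card fun w hw => ?_
    rw [SimpleGraph.mem_neighborFinset]
    rcases Finset.mem_insert.mp hw with rfl | hw
    · exact hzv
    · rwa [Finset.mem_singleton.mp hw]
  have hsum := (fracGraph x).sum_degrees_eq_twice_card_edges
  have hedge : (fracGraph x).edgeFinset = fracSet x := by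
    rw [← Finset.coe_inj, SimpleGraph.coe_edgeFinset, edgeSet_fracGraph hG]
  rw [hedge] at hsum
  have hS2 : ∑ z ∈ S, (fracGraph x).degree z ≤ ∑ z, (fracGraph x).degree z :=
    Finset.sum_le_sum_of_subset (subset_univ _)
  have hlow : ∑ z ∈ S, 2 ≤ ∑ z ∈ S, (fracGraph x).degree z := Finset.sum_le_sum hdeg
  have hconst : ∑ z ∈ S, 2 = 2 * #S := by rw [sum_const, smul_eq_mul, mul_comm]
  refine ⟨by omega, fun z hz => ?_⟩
  exact ((Finset.sum_eq_sum_iff_of_le hdeg).mp (by omega) z ((hmem z).mpr hz)).symm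

/-- Every vertex on a nonintegral edge lies on an odd cycle of nonintegral edges covering its
component. -/
lemma exists_odd_cycle (hx : IsMinFrac a b x) (hG : ∀ e ∈ fracSet x, e ∈ G.edgeSet)
    (hint : ∀ z, edgeSum ℚ x z ∈ (Int.castRingHom ℚ).range)
    {z : V} (hz : ∃ e ∈ fracSet x, z ∈ e) :
    ∃ p : (fracGraph x).Walk z z, p.IsCycle ∧ Odd p.length ∧
      ∀ u, u ∈ p.support ↔ (fracGraph x).Reachable u z := by
  classical
  have hdeg := (hx.degree_fracGraph hG hint).2
  have hcyc : (fracGraph x).IsCycles := by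
    rintro v ⟨u, hu⟩
    rw [Set.ncard_eq_toFinset_card', ← SimpleGraph.neighborFinset_def,
      SimpleGraph.card_neighborFinset_eq_degree]
    exact hdeg v ⟨s(v, u), (fracGraph_adj hG).mp hu, Sym2.mem_mk_left v u⟩
  obtain ⟨e, he, u, rfl⟩ := hz
  obtain ⟨p, hp, hsupp⟩ := hcyc.exists_cycle_toSubgraph_verts_eq_connectedComponentSupp
    (c := (fracGraph x).connectedComponentMk z) rfl ⟨u, (fracGraph_adj hG).mpr he⟩
  refine ⟨p, hp, ?_, fun v => ?_⟩
  · rw [← Nat.not_even_iff_odd]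
    intro heven
    have h0 := hx.eq_zero_of_edgeSum_eq_zero (d := fun e => (altWeight p e : ℚ))
      (fun e he => by
        rw [altWeight_eq_zero fun h => he (mem_fracSet_of_mem_edges h), Int.cast_zero])
      (by
        ext v
        rw [edgeSum_cast, edgeSum_altWeight, heven.neg_one_pow]
        simp)
    obtain ⟨e, he⟩ := List.exists_mem_of_ne_nil p.edges
      (fun h => hp.ne_nil (SimpleGraph.Walk.edges_eq_nil.mp h).eq_nil)
    have h1 := congrFun h0 e
    rcases altWeight_of_isTrail hp.isTrail he with h | h <;> simp [h] at h1
  · rw [← SimpleGraph.Walk.mem_verts_toSubgraph, hsupp, SimpleGraph.ConnectedComponent.mem_supp_iff,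
      SimpleGraph.ConnectedComponent.eq]

lemma two_mul_mem_range (hx : IsMinFrac a b x) (hG : ∀ e ∈ fracSet x, e ∈ G.edgeSet)
    (hint : ∀ z, edgeSum ℚ x z ∈ (Int.castRingHom ℚ).range)
    {e : Sym2 V} (he : e ∈ fracSet x) :
    2 * x e ∈ (Int.castRingHom ℚ).range := by
  have hA : ∀ z, ∃ A : Sym2 V → ℤ, (∀ e ∉ fracSet x, A e = 0) ∧
      ((∃ e ∈ fracSet x, z ∈ e) → edgeSum ℤ A = 2 • Pi.single z 1) := by
    intro z
    by_cases hz : ∃ e ∈ fracSet x, z ∈ e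
    · obtain ⟨p, -, hodd, -⟩ := hx.exists_odd_cycle hG hint hz
      refine ⟨altWeight p, fun e he => altWeight_eq_zero fun h => he (mem_fracSet_of_mem_edges h),
        fun _ => ?_⟩
      rw [edgeSum_altWeight, hodd.neg_one_pow, neg_smul, one_smul, sub_neg_eq_add, two_smul]
    · exact ⟨0, fun _ _ => rfl, fun h => absurd h hz⟩
  choose A hA0 hA using hA
  set y : Sym2 V → ℚ := fun e => if e ∈ fracSet x then x e else 0 with hy
  have hyint : ∀ z, edgeSum ℚ y z ∈ (Int.castRingHom ℚ).range := by
    intro z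
    have h : edgeSum ℚ y z = edgeSum ℚ x z - edgeSum ℚ (x - y) z := by
      rw [map_sub, Pi.sub_apply]
      ring
    rw [h]
    refine sub_mem (hint z) (sum_mem fun e _ => mul_mem ?_ ⟨_, rfl⟩)
    by_cases he : e ∈ fracSet x
    · simp [hy, he]
    · simpa [hy, he] using notMem_fracSet.mp he
  choose n hn using hyint
  have hn0 : ∀ z, (¬ ∃ e ∈ fracSet x, z ∈ e) → edgeSum ℚ y z = 0 := by
    intro z hz
    refine Finset.sum_eq_zero fun e _ => ?_
    by_cases he : e ∈ fracSet x
    · have : z ∉ e := fun h => hz ⟨e, he, h⟩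
      simp [edgeVec, this]
    · simp [hy, he]
  have hzero := hx.eq_zero_of_edgeSum_eq_zero
    (d := (2 : ℚ) • y - ∑ z, (n z : ℚ) • fun e => (A z e : ℚ))
    (fun e he => by simp [hy, he, hA0 _ e he])
    (by
      ext v
      rw [map_sub, map_sum, map_smul, Pi.sub_apply, Finset.sum_apply, Finset.sum_eq_single v]
      · by_cases hv : ∃ e ∈ fracSet x, v ∈ e
        · rw [map_smul, Pi.smul_apply, Pi.smul_apply, edgeSum_cast, hA v hv, ← hn v]
          simp [mul_comm]
        · have h0 : (n v : ℚ) = 0 := (hn v).trans (hn0 v hv)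
          simp [h0, hn0 v hv]
      · intro z _ hzv
        by_cases hz : ∃ e ∈ fracSet x, z ∈ e
        · rw [map_smul, Pi.smul_apply, edgeSum_cast, hA z hz]
          simp [hzv.symm]
        · have h0 : (n z : ℚ) = 0 := (hn z).trans (hn0 z hz)
          simp [h0]
      · simp)
  refine ⟨∑ z, n z * A z e, ?_⟩
  have h := congrFun hzero e
  simp only [Pi.sub_apply, Pi.smul_apply, smul_eq_mul, hy, he, if_true, Finset.sum_apply,
    Pi.zero_apply, sub_eq_zero] at h
  rw [h]
  simp

lemma exists_eq_add_half (hx : IsMinFrac a b x) (hG : ∀ e ∈ fracSet x, e ∈ G.edgeSet)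
    (hint : ∀ z, edgeSum ℚ x z ∈ (Int.castRingHom ℚ).range)
    {e : Sym2 V} (he : e ∈ fracSet x) :
    ∃ n : ℤ, x e = n + 1 / 2 ∧ a e ≤ n ∧ n + 1 ≤ b e := by
  obtain ⟨m, hm⟩ := hx.two_mul_mem_range hG hint he
  rw [eq_intCast] at hm
  obtain ⟨n, rfl | rfl⟩ := Int.even_or_odd' m
  · refine absurd he (notMem_fracSet.mpr ⟨n, ?_⟩)
    rw [eq_intCast]
    push_cast at hm
    linarith
  · push_cast at hm
    have hxe : x e = n + 1 / 2 := by linarith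
    obtain ⟨h1, h2⟩ := hx.mem_box e
    refine ⟨n, hxe, ?_, ?_⟩
    · have : (a e : ℚ) < n + 1 := by linarith
      exact Int.lt_add_one_iff.mp (by exact_mod_cast this)
    · have : (n : ℚ) < b e := by linarith
      exact Int.add_one_le_iff.mpr (by exact_mod_cast this)

end IsMinFrac

end FracGraph

section OddCycleCondition

variable {V : Type*} [Fintype V] [DecidableEq V]

/-- The odd-cycle condition: disjoint odd cycles are joined by an edge. -/
def OddCycleCondition (G : SimpleGraph V) : Prop :=
  ∀ (x y : V) (c₁ : G.Walk x x) (c₂ : G.Walk y y),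
    c₁.IsCycle → c₂.IsCycle → Odd c₁.length → Odd c₂.length →
    (∀ z, z ∈ c₁.support → z ∉ c₂.support) →
    ∃ p ∈ c₁.support, ∃ q ∈ c₂.support, G.Adj p q

namespace IsMinFrac

variable {G : SimpleGraph V} {a b : Sym2 V → ℤ} {x : Sym2 V → ℚ}

/-- Under the odd-cycle condition, the nonintegral edges of a minimal weighting form a single
component. -/
lemma reachable_of_oddCycleCondition (hx : IsMinFrac a b x) (hG : ∀ e ∈ fracSet x, e ∈ G.edgeSet)
    (hint : ∀ z, edgeSum ℚ x z ∈ (Int.castRingHom ℚ).range)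
    (hab : ∀ e ∈ G.edgeSet, a e < b e)
    (hodd : OddCycleCondition G) {z z' : V} (hz : ∃ e ∈ fracSet x, z ∈ e)
    (hz' : ∃ e ∈ fracSet x, z' ∈ e) : (fracGraph x).Reachable z z' := by
  by_contra hzz'
  obtain ⟨c, hc, hco, hcs⟩ := hx.exists_odd_cycle hG hint hz
  obtain ⟨c', hc', hco', hcs'⟩ := hx.exists_odd_cycle hG hint hz'
  have hdisj : ∀ v, v ∈ c.support → v ∉ c'.support := fun v hv hv' =>
    hzz' (((hcs v).mp hv).symm.trans ((hcs' v).mp hv'))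
  have hle := fracGraph_le hG
  obtain ⟨p, hp, q, hq, hpq⟩ := hodd z z' (c.mapLe hle) (c'.mapLe hle) (hc.mapLe hle)
    (hc'.mapLe hle) (by simpa using hco) (by simpa using hco') (by simpa using hdisj)
  rw [SimpleGraph.Walk.support_mapLe_eq_support] at hp hq
  have hf : s(p, q) ∉ fracSet x := fun hf => hzz' <|
    ((hcs p).mp hp).symm.trans <| ((fracGraph_adj hG).mpr hf).reachable.trans ((hcs' q).mp hq)
  obtain ⟨m, hm⟩ := notMem_fracSet.mp hf
  rw [eq_intCast] at hm
  obtain ⟨s, hs, hsa, hsb⟩ : ∃ s : ℤ, (s = 1 ∨ s = -1) ∧ a s(p, q) ≤ m + s ∧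
      m + s ≤ b s(p, q) := by
    have h1 := hab s(p, q) hpq
    have h2 := hx.mem_box s(p, q)
    rw [← hm] at h2
    norm_cast at h2
    by_cases h : m + 1 ≤ b s(p, q)
    · exact ⟨1, .inl rfl, by omega, h⟩
    · exact ⟨-1, .inr rfl, by omega, by omega⟩
  set r := c.rotate p hp with hr
  set r' := c'.rotate q hq with hr'
  have hrt : r.IsTrail := (hc.rotate hp).isTrail
  have hrt' : r'.IsTrail := (hc'.rotate hq).isTrail
  have hre : ∀ e, e ∈ r.edges ↔ e ∈ c.edges := fun e => (c.rotate_edges p hp).mem_iff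
  have hre' : ∀ e, e ∈ r'.edges ↔ e ∈ c'.edges := fun e => (c'.rotate_edges q hq).mem_iff
  have hrsum : edgeSum ℤ (altWeight r) = 2 • Pi.single p 1 := by
    have : Odd r.length := by simpa [hr] using hco
    rw [edgeSum_altWeight, this.neg_one_pow, neg_smul, one_smul, sub_neg_eq_add, two_smul]
  have hrsum' : edgeSum ℤ (altWeight r') = 2 • Pi.single q 1 := by
    have : Odd r'.length := by simpa [hr'] using hco'
    rw [edgeSum_altWeight, this.neg_one_pow, neg_smul, one_smul, sub_neg_eq_add, two_smul]
  have hedisj : ∀ e, e ∈ r.edges → e ∉ r'.edges := by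
    intro e he he'
    rw [hre] at he
    rw [hre'] at he'
    induction e with
    | h u v =>
      exact hdisj u (c.fst_mem_support_of_mem_edges he) (c'.fst_mem_support_of_mem_edges he')
  set A : Sym2 V → ℤ := altWeight r + altWeight r' with hA
  have hA1 : ∀ e ∈ fracSet x, A e = 1 ∨ A e = -1 ∨ A e = 0 := by
    intro e _
    by_cases he : e ∈ r.edges
    · have h1 := altWeight_of_isTrail hrt he
      have h2 := altWeight_eq_zero (hedisj e he)
      simp only [hA, Pi.add_apply]
      omega
    · by_cases he' : e ∈ r'.edges
      · have h1 := altWeight_of_isTrail hrt' he'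
        have h2 := altWeight_eq_zero he
        simp only [hA, Pi.add_apply]
        omega
      · simp [hA, altWeight_eq_zero he, altWeight_eq_zero he']
  have hA0 : ∀ e ∉ fracSet x, A e = 0 := fun e he => by
    simp [hA, altWeight_eq_zero fun h => he (mem_fracSet_of_mem_edges h)]
  set y : Sym2 V → ℚ :=
    x + Pi.single s(p, q) (s : ℚ) - ((s : ℚ) / 2) • fun e => (A e : ℚ) with hy
  have hysum : edgeSum ℚ y = edgeSum ℚ x := by
    ext v
    rw [hy, map_sub, map_add, map_smul, Pi.sub_apply, Pi.smul_apply, edgeSum_cast, hA, map_add,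
      hrsum, hrsum', edgeSum_single hpq.ne]
    simp only [Pi.add_apply, Pi.single_apply, Pi.smul_apply]
    split_ifs <;> simp
    ring
  have hyfrac : ∀ e ∈ fracSet x, A e ≠ 0 → ∃ n : ℤ, y e = n ∧ a e ≤ n ∧ n ≤ b e := by
    intro e he hAe
    obtain ⟨n, hn, hna, hnb⟩ := hx.exists_eq_add_half hG hint he
    have hef : e ≠ s(p, q) := fun h => hf (h ▸ he)
    have hye : y e = n + 1 / 2 - (s : ℚ) / 2 * A e := by simp [hy, hef, hn]
    rcases hA1 e he with h | h | h
    · rcases hs with rfl | rfl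
      · exact ⟨n, by rw [hye, h]; push_cast; ring, hna, by omega⟩
      · exact ⟨n + 1, by rw [hye, h]; push_cast; ring, by omega, hnb⟩
    · rcases hs with rfl | rfl
      · exact ⟨n + 1, by rw [hye, h]; push_cast; ring, by omega, hnb⟩
      · exact ⟨n, by rw [hye, h]; push_cast; ring, hna, by omega⟩
    · exact absurd h hAe
  have hystep : ∀ e, y e = x e ∨ ∃ n : ℤ, y e = n ∧ a e ≤ n ∧ n ≤ b e := by
    intro e
    by_cases he : e ∈ fracSet x
    · by_cases hAe : A e = 0
      · have hef : e ≠ s(p, q) := fun h => hf (h ▸ he)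
        exact .inl (by simp [hy, hef, hAe])
      · exact .inr (hyfrac e he hAe)
    · by_cases hef : e = s(p, q)
      · subst hef
        exact .inr ⟨m + s, by simp [hy, hA0 _ he, hm], hsa, hsb⟩
      · exact .inl (by simp [hy, hA0 _ he, hef])
  obtain ⟨e, he⟩ := List.exists_mem_of_ne_nil c.edges
    (fun h => hc.ne_nil (SimpleGraph.Walk.edges_eq_nil.mp h).eq_nil)
  have heF : e ∈ fracSet x := mem_fracSet_of_mem_edges he
  rw [← hre] at he
  obtain ⟨n, hn, -⟩ := hyfrac e heF (by
    have h1 := altWeight_of_isTrail hrt he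
    have h2 := altWeight_eq_zero (hedisj e he)
    simp only [hA, Pi.add_apply]
    omega)
  exact notMem_fracSet.mpr ⟨n, hn.symm⟩ (hx.mem_fracSet_of_integral_step hystep hysum heF)

/-- If the nonintegral edges form a single component, their number is odd. -/
lemma odd_card_fracSet (hx : IsMinFrac a b x) (hG : ∀ e ∈ fracSet x, e ∈ G.edgeSet)
    (hint : ∀ z, edgeSum ℚ x z ∈ (Int.castRingHom ℚ).range)
    (hconn : ∀ z z', (∃ e ∈ fracSet x, z ∈ e) → (∃ e ∈ fracSet x, z' ∈ e) →
    (fracGraph x).Reachable z z') (hne : (fracSet x).Nonempty) : Odd #(fracSet x) := by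
  classical
  obtain ⟨e, he⟩ := hne
  induction e with
  | h z u =>
    have hz : ∃ e ∈ fracSet x, z ∈ e := ⟨_, he, Sym2.mem_mk_left z u⟩
    obtain ⟨p, hp, hodd, hsupp⟩ := hx.exists_odd_cycle hG hint hz
    have hS : ({v : V | ∃ e ∈ fracSet x, v ∈ e} : Finset V) = p.support.tail.toFinset := by
      ext v
      rw [mem_filter, List.mem_toFinset]
      constructor
      · rintro ⟨-, hv⟩
        rcases p.mem_support_iff.mp ((hsupp v).mpr (hconn v z hv hz)) with rfl | h
        · exact SimpleGraph.Walk.end_mem_tail_support hp.not_nil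
        · exact h
      · intro hv
        have hv' := List.mem_of_mem_tail hv
        obtain ⟨e, he, hve⟩ :=
          (SimpleGraph.Walk.mem_support_iff_exists_mem_edges_of_not_nil hp.not_nil).mp hv'
        exact ⟨mem_univ v, e, mem_fracSet_of_mem_edges he, hve⟩
    rw [(hx.degree_fracGraph hG hint).1, hS, List.toFinset_card_of_nodup hp.support_nodup]
    simpa using hodd

end IsMinFrac

lemma OddCycleCondition.graphWFR {G : SimpleGraph V} [DecidableRel G.Adj]
    (hodd : OddCycleCondition G) : GraphWFR G := by
  rw [graphWFR_iff]
  intro a b hab hab' c hc x₀ hx₀ hxc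
  obtain ⟨x, hx, hxx₀⟩ := exists_isMinFrac hx₀
  have hx0 : ∀ e ∉ G.edgeSet, x e = 0 := fun e he => by
    have h := hx.mem_box e
    rw [(hab' e he).1, (hab' e he).2] at h
    exact le_antisymm (by simpa using h.2) (by simpa using h.1)
  have hG : ∀ e ∈ fracSet x, e ∈ G.edgeSet := fun e he => by
    by_contra h
    exact notMem_fracSet.mpr ⟨0, by simp [hx0 e h]⟩ he
  have hsum : ∀ z, edgeSum ℚ x z = ((edgeSum ℤ c z : ℤ) : ℚ) := fun z => by rw [hxx₀, hxc]
  have hint : ∀ z, edgeSum ℚ x z ∈ (Int.castRingHom ℚ).range := fun z => ⟨_, (hsum z).symm⟩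
  rcases (fracSet x).eq_empty_or_nonempty with hF | hF
  · have hxint : ∀ e, x e ∈ (Int.castRingHom ℚ).range := fun e =>
      notMem_fracSet.mp (by simp [hF])
    choose y hy using hxint
    simp only [eq_intCast] at hy
    refine ⟨y, fun e => ?_, ?_⟩
    · have h := hx.mem_box e
      rw [← hy] at h
      exact_mod_cast h
    · ext z
      have h := hsum z
      rw [← funext hy, edgeSum_cast] at h
      exact_mod_cast h
  · exfalso
    have hcard := hx.odd_card_fracSet hG hint (fun z z' hz hz' =>
      hx.reachable_of_oddCycleCondition hG hint hab hodd hz hz') hF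
    have hn : ∀ e, ∃ n : ℤ, x e = n + if e ∈ fracSet x then 1 / 2 else 0 := by
      intro e
      by_cases he : e ∈ fracSet x
      · obtain ⟨n, hn, -⟩ := hx.exists_eq_add_half hG hint he
        exact ⟨n, by simp [hn, he]⟩
      · obtain ⟨n, hn⟩ := notMem_fracSet.mp he
        exact ⟨n, by simpa [he] using hn.symm⟩
    choose n hn using hn
    have h1 : ∑ e, x e = ∑ e, (c e : ℚ) := by
      have h := sum_edgeSum hx0
      have h' := sum_edgeSum (R := ℤ) hc
      simp only [hsum] at h
      rw [← Int.cast_sum, h'] at h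
      push_cast at h
      linarith
    have h2 : ∑ e, x e = ∑ e, (n e : ℚ) + #(fracSet x) * (1 / 2) := by
      rw [Finset.sum_congr rfl fun e _ => hn e, sum_add_distrib]
      simp
    have h3 : ((#(fracSet x) : ℤ) : ℚ) = ((2 * (∑ e, c e - ∑ e, n e) : ℤ) : ℚ) := by
      push_cast
      linarith
    have h4 : (#(fracSet x) : ℤ) = 2 * (∑ e, c e - ∑ e, n e) := by exact_mod_cast h3
    obtain ⟨k, hk⟩ := hcard
    omega

end OddCycleCondition

theorem stmt11 {V : Type*} [Fintype V] [DecidableEq V] (G : SimpleGraph V)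
    [DecidableRel G.Adj] (hG : G.Connected) :
    GraphWFR G ↔
      ∀ (x y : V) (c₁ : G.Walk x x) (c₂ : G.Walk y y),
        c₁.IsCycle → c₂.IsCycle → Odd c₁.length → Odd c₂.length →
        (∀ z, z ∈ c₁.support → z ∉ c₂.support) →
        ∃ p ∈ c₁.support, ∃ q ∈ c₂.support, G.Adj p q := by
  refine ⟨fun h x y c₁ c₂ hc₁ hc₂ ho₁ ho₂ hd => ?_, fun h => OddCycleCondition.graphWFR h⟩
  exact h.exists_adj hG hc₁.isTrail hc₂.isTrail ho₁ ho₂ hd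
end

section
/- If a connected simple graph G contains two vertex-disjoint simple odd cycles at graph distance greater than 1 (no edge between them), then G is not weakly Farkas. -/
open Finset

/-- The edges of a walk, counted with multiplicity, cover each vertex twice per visit, except that
the two ends are covered once less. -/
theorem sum_edgeVec_edges {V : Type*} [DecidableEq V] {G : SimpleGraph V} {u v : V}
    (p : G.Walk u v) (z : V) :
    (p.edges.map fun e => edgeVec e z).sum
      = 2 * (p.support.count z : ℤ) - (if u = z then 1 else 0) - (if v = z then 1 else 0) := by
  induction p with
  | nil =>
    simp only [SimpleGraph.Walk.edges_nil, SimpleGraph.Walk.support_nil, List.map_nil,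
      List.sum_nil, List.count_singleton, beq_iff_eq]
    split_ifs <;> simp
  | @cons a b c h p ih =>
    have hab : edgeVec s(a, b) z = (if a = z then 1 else 0) + (if b = z then 1 else 0) := by
      have := h.ne
      simp only [edgeVec, Sym2.mem_iff]
      grind
    simp only [SimpleGraph.Walk.edges_cons, SimpleGraph.Walk.support_cons, List.map_cons,
      List.sum_cons, ih, hab, List.count_cons, beq_iff_eq]
    push_cast
    ring

/-- The edges of a closed walk cover each vertex twice per visit. -/
theorem sum_edgeVec_edges_of_closed {V : Type*} [DecidableEq V] {G : SimpleGraph V} {u : V}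
    (p : G.Walk u u) (z : V) :
    (p.edges.map fun e => edgeVec e z).sum = 2 * (p.support.tail.count z : ℤ) := by
  rw [sum_edgeVec_edges, ← p.cons_tail_support]
  simp only [List.count_cons, List.tail_cons, beq_iff_eq]
  push_cast
  ring

theorem sum_count_edges_mul {V : Type*} [Fintype V] [DecidableEq V] {G : SimpleGraph V}
    [DecidableRel G.Adj] {u v : V} (p : G.Walk u v) (f : Sym2 V → ℤ) :
    ∑ e : G.edgeFinset, (p.edges.count (e : Sym2 V) : ℤ) * f e = (p.edges.map f).sum := by
  rw [Finset.sum_coe_sort G.edgeFinset (fun e => (p.edges.count e : ℤ) * f e),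
    Finset.sum_list_map_count]
  simp only [nsmul_eq_mul]
  symm
  apply Finset.sum_subset
  · intro e he
    rw [SimpleGraph.mem_edgeFinset]
    exact p.edges_subset_edgeSet (List.mem_toFinset.1 he)
  · intro e _ he
    rw [List.mem_toFinset] at he
    simp [List.count_eq_zero_of_not_mem he]

/-- The lattice spanned by the edge vectors of a graph. -/
def edgeLattice {V : Type*} [Fintype V] [DecidableEq V] (G : SimpleGraph V)
    [DecidableRel G.Adj] : Submodule ℤ (V → ℤ) :=
  Submodule.span ℤ (Set.range fun e : G.edgeFinset => edgeVec (e : Sym2 V))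

section edgeLattice

variable {V : Type*} [Fintype V] [DecidableEq V] {G : SimpleGraph V} [DecidableRel G.Adj]

theorem single_add_single_mem_edgeLattice {u v : V} (h : G.Adj u v) :
    (Pi.single u 1 + Pi.single v 1 : V → ℤ) ∈ edgeLattice G := by
  refine Submodule.subset_span ⟨⟨s(u, v), SimpleGraph.mem_edgeFinset.2 h⟩, ?_⟩
  funext z
  have := h.ne
  simp only [edgeVec, Sym2.mem_iff, Pi.add_apply, Pi.single_apply]
  grind

theorem single_sub_single_mem_edgeLattice_of_walk {u v : V} (p : G.Walk u v) :
    (Pi.single u 1 - (-1 : ℤ) ^ p.length • Pi.single v 1 : V → ℤ) ∈ edgeLattice G := by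
  induction p with
  | nil => simp
  | @cons a b c h p ih =>
    convert sub_mem (single_add_single_mem_edgeLattice h) ih using 1
    rw [SimpleGraph.Walk.length_cons, pow_succ]
    module

theorem two_smul_single_mem_edgeLattice {u : V} (p : G.Walk u u) (hp : Odd p.length) :
    ((2 : ℤ) • Pi.single u 1 : V → ℤ) ∈ edgeLattice G := by
  convert single_sub_single_mem_edgeLattice_of_walk p using 1
  rw [hp.neg_one_pow]
  module

/-- In a connected graph with an odd closed walk, every integer vector with even coordinate sum
lies in the edge lattice. -/
theorem mem_edgeLattice_of_even_sum (hG : G.Connected) {u : V} (p : G.Walk u u)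
    (hp : Odd p.length) (w : V → ℤ) (hw : Even (∑ z, w z)) : w ∈ edgeLattice G := by
  have h2 := two_smul_single_mem_edgeLattice p hp
  have hsub (z : V) : (Pi.single z 1 - Pi.single u 1 : V → ℤ) ∈ edgeLattice G := by
    obtain ⟨q⟩ := hG.preconnected z u
    have hq := single_sub_single_mem_edgeLattice_of_walk q
    rcases Nat.even_or_odd q.length with h | h
    · simpa [h.neg_one_pow] using hq
    · convert sub_mem hq h2 using 1
      rw [h.neg_one_pow]
      module
  obtain ⟨k, hk⟩ := hw
  have key : w = ∑ z, w z • (Pi.single z 1 - Pi.single u 1 : V → ℤ)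
      + k • ((2 : ℤ) • Pi.single u 1 : V → ℤ) := by
    simp only [smul_sub, Finset.sum_sub_distrib, ← Finset.sum_smul, hk]
    have : ∑ z, w z • (Pi.single z 1 : V → ℤ) = w := by
      funext j
      simp [Finset.sum_apply, Pi.single_apply]
    rw [this]
    module
  rw [key]
  exact add_mem (sum_mem fun z _ => Submodule.smul_mem _ _ (hsub z)) (Submodule.smul_mem _ _ h2)

end edgeLattice

theorem sum_count_support_tail {V : Type*} [DecidableEq V] {G : SimpleGraph V} {u : V}
    (p : G.Walk u u) (s : Finset V) (hs : ∀ z ∈ p.support, z ∈ s) :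
    ∑ z ∈ s, (p.support.tail.count z : ℤ) = p.length := by
  have hlen : p.support.tail.length = p.length := by simp
  rw [← Nat.cast_sum, ← hlen]
  simpa using congrArg (Nat.cast : ℕ → ℤ) (Multiset.sum_count_eq_card (s := s)
    (m := (p.support.tail : Multiset V)) fun z hz => hs z (List.mem_of_mem_tail hz))

/-- If all edges leaving a set `s` have weight zero, the covered weight of `s` is even. -/
theorem even_sum_sum_mul_edgeVec {V : Type*} [Fintype V] [DecidableEq V] {G : SimpleGraph V}
    [DecidableRel G.Adj] (s : Finset V) (f : G.edgeFinset → ℤ)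
    (hf : ∀ e : G.edgeFinset, ∀ p ∈ s, ∀ q ∉ s, (e : Sym2 V) = s(p, q) → f e = 0) :
    Even (∑ z ∈ s, ∑ e : G.edgeFinset, f e * edgeVec (e : Sym2 V) z) := by
  rw [Finset.sum_comm]
  refine Finset.even_sum _ fun e _ => ?_
  rw [← Finset.mul_sum]
  obtain ⟨e, he⟩ := e
  induction e using Sym2.ind with
  | _ p q =>
    have hpq : p ≠ q := (SimpleGraph.mem_edgeFinset.1 he : G.Adj p q).ne
    have hsum : ∑ z ∈ s, edgeVec s(p, q) z
        = (if p ∈ s then 1 else 0) + (if q ∈ s then 1 else 0) := by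
      have hvec (z : V) :
          edgeVec s(p, q) z = (if p = z then 1 else 0) + (if q = z then 1 else 0) := by
        simp only [edgeVec, Sym2.mem_iff]
        grind
      simp [hvec, Finset.sum_add_distrib]
    rw [hsum]
    by_cases hp : p ∈ s <;> by_cases hq : q ∈ s
    · simp [hp, hq]
    · simp [hf ⟨_, he⟩ p hp q hq rfl]
    · simp [hf ⟨_, he⟩ q hq p hp Sym2.eq_swap]
    · simp [hp, hq]

theorem stmt12 {V : Type*} [Fintype V] [DecidableEq V] (G : SimpleGraph V)
    [DecidableRel G.Adj] (hG : G.Connected)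
    (x y : V) (c₁ : G.Walk x x) (c₂ : G.Walk y y)
    (h₁ : c₁.IsCycle) (h₂ : c₂.IsCycle) (ho₁ : Odd c₁.length) (ho₂ : Odd c₂.length)
    (hdisj : ∀ z, z ∈ c₁.support → z ∉ c₂.support)
    (hfar : ¬ ∃ p ∈ c₁.support, ∃ q ∈ c₂.support, G.Adj p q) :
    ¬ GraphWFR G := by
  intro hW
  set w : V → ℤ := fun z => c₁.support.tail.count z + c₂.support.tail.count z with hw
  set m : G.edgeFinset → ℤ :=
    fun e => c₁.edges.count (e : Sym2 V) + c₂.edges.count (e : Sym2 V) with hm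
  have hm0 (e) : 0 ≤ m e := by positivity
  have hmw (j : V) : ∑ e, m e * edgeVec (e : Sym2 V) j = 2 * w j := by
    simp only [hm, add_mul, Finset.sum_add_distrib]
    rw [sum_count_edges_mul c₁ (fun e => edgeVec e j),
      sum_count_edges_mul c₂ (fun e => edgeVec e j), sum_edgeVec_edges_of_closed,
      sum_edgeVec_edges_of_closed]
    ring
  have hlat : ∃ c : G.edgeFinset → ℤ, ∀ j, w j = ∑ e, c e * edgeVec (e : Sym2 V) j := by
    have hmem : w ∈ edgeLattice G := by
      refine mem_edgeLattice_of_even_sum hG c₁ ho₁ w ?_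
      simp only [hw, Finset.sum_add_distrib]
      rw [sum_count_support_tail c₁ _ (by simp), sum_count_support_tail c₂ _ (by simp)]
      exact_mod_cast ho₁.add_odd ho₂
    obtain ⟨c, hc⟩ := (Submodule.mem_span_range_iff_exists_fun ℤ).1 hmem
    exact ⟨c, fun j => by simp [← hc, Finset.sum_apply]⟩
  have hrat : ∃ r : G.edgeFinset → ℚ, (∀ e, ((0 : ℤ) : ℚ) ≤ r e ∧ r e ≤ ((m e + 1 : ℤ) : ℚ)) ∧
      ∀ j, (w j : ℚ) = ∑ e, r e * ((edgeVec (e : Sym2 V) j : ℤ) : ℚ) := by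
    refine ⟨fun e => (m e : ℚ) / 2, fun e => ?_, fun j => ?_⟩
    · have : (0 : ℚ) ≤ m e := by exact_mod_cast hm0 e
      constructor <;> push_cast <;> linarith
    · have h : ∑ e, (m e : ℚ) * ((edgeVec (e : Sym2 V) j : ℤ) : ℚ) = 2 * (w j : ℚ) := by
        exact_mod_cast hmw j
      simp only [div_mul_eq_mul_div, ← Finset.sum_div, h]
      ring
  obtain ⟨f, hf, hfw⟩ := hW (fun _ => 0) (fun e => m e + 1)
    (fun e => by have := hm0 e; omega) w hlat hrat
  have hodd : ∑ z ∈ c₁.support.toFinset, w z = c₁.length := by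
    simp only [hw, Finset.sum_add_distrib]
    rw [sum_count_support_tail c₁ _ (by simp), add_eq_left]
    refine Finset.sum_eq_zero fun z hz => ?_
    rw [List.mem_toFinset] at hz
    rw [List.count_eq_zero_of_not_mem fun h => hdisj z hz (List.mem_of_mem_tail h)]
    rfl
  have heven : Even (∑ z ∈ c₁.support.toFinset, w z) := by
    simp only [hfw]
    refine even_sum_sum_mul_edgeVec _ f fun e p hp q hq he => ?_
    rw [List.mem_toFinset] at hp hq
    have hadj : G.Adj p q := by
      have := SimpleGraph.mem_edgeFinset.1 e.2
      rwa [he] at this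
    have hq₂ : q ∉ c₂.support := fun h => hfar ⟨p, hp, q, h, hadj⟩
    have hwq : w q = 0 := by
      simp [hw, List.count_eq_zero_of_not_mem (fun h => hq (List.mem_of_mem_tail h)),
        List.count_eq_zero_of_not_mem (fun h => hq₂ (List.mem_of_mem_tail h))]
    have hterm := (Finset.sum_eq_zero_iff_of_nonneg (s := Finset.univ)
      (f := fun e : G.edgeFinset => f e * edgeVec (e : Sym2 V) q) (fun e _ =>
        mul_nonneg (hf e).1 (by unfold edgeVec; split_ifs <;> simp))).1
      ((hfw q).symm.trans hwq) e (Finset.mem_univ e)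
    simpa [edgeVec, he] using hterm
  rw [hodd] at heven
  have : Even c₁.length := by exact_mod_cast heven
  exact Nat.not_even_iff_odd.2 ho₁ this
end
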